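/- For any three roots δ₁, δ₂, δ₃ ∈ R with B(δ₁,δ₂) = 1, B(δ₁,δ₃) = 0, B(δ₂,δ₃) = 0 and δ₃ ≠ ±δ₁, δ₃ ≠ ±δ₂ (so that they span a sub-root system of type A₁ + A₂), the number of orbits of the subgroup generated by the reflections r_{δ₁}, r_{δ₂}, r_{δ₃} acting on the 72-element set R is exactly 22. (The A₁+A₂ row of Table 1: a cubic surface hyperplane section with one A₁ and one A₂ singularity has exactly 22 limiting primitive vanishing cycles.) -/

import Mathlib

/-- The intersection form on the lattice `I^{1,6} ≅ H²(S,ℤ)` of a smooth cubic surface. -/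
def B (x y : Fin 7 → ℤ) : ℤ := x 0 * y 0 - ∑ i : Fin 6, x i.succ * y i.succ

/-- The hyperplane class `h = 3e₀ - e₁ - ⋯ - e₆`. -/
def h : Fin 7 → ℤ := fun j => if j = 0 then 3 else -1

/-- The root system `R = {α : B(α,α) = -2, B(α,h) = 0}` (primitive vanishing cycles). -/
def R : Set (Fin 7 → ℤ) := {α | B α α = -2 ∧ B α h = 0}

/-- The reflection `r_α(β) = β + B(β,α)·α` in a root `α`. -/
def reflect (α β : Fin 7 → ℤ) : Fin 7 → ℤ := β + B β α • α

/-! Roots as explicit 7-tuples, for kernel computation. -/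

abbrev T7 := ℤ × ℤ × ℤ × ℤ × ℤ × ℤ × ℤ

def distT : T7 → T7 → ℕ
  | (a, b, c, d, e, f, g), (a', b', c', d', e', f', g') =>
    Int.natAbs (Int.sub a a') + Int.natAbs (Int.sub b b') + Int.natAbs (Int.sub c c')
      + Int.natAbs (Int.sub d d') + Int.natAbs (Int.sub e e') + Int.natAbs (Int.sub f f')
      + Int.natAbs (Int.sub g g')

theorem distT_eq (x y : T7) : distT x y = 0 ↔ x = y := by
  obtain ⟨a, b, c, d, e, f, g⟩ := x
  obtain ⟨a', b', c', d', e', f', g'⟩ := y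
  have sub_def : ∀ u v : ℤ, Int.sub u v = u - v := fun _ _ => rfl
  simp only [distT, sub_def, Prod.mk.injEq]
  omega

def eqT (x y : T7) : Bool := Nat.beq (distT x y) 0

theorem eqT_iff (x y : T7) : eqT x y = true ↔ x = y := by
  rw [eqT, Nat.beq_eq, distT_eq]

instance instDecEqT7 : DecidableEq T7 := fun x y => decidable_of_iff _ (eqT_iff x y)

def toF : T7 → (Fin 7 → ℤ)
  | (a, b, c, d, e, f, g) => ![a, b, c, d, e, f, g]

def BT : T7 → T7 → ℤ
  | (a, b, c, d, e, f, g), (a', b', c', d', e', f', g') =>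
    a * a' - (b * b' + c * c' + d * d' + e * e' + f * f' + g * g')

def axT (k : ℤ) : T7 → T7 → T7
  | (a, b, c, d, e, f, g), (a', b', c', d', e', f', g') =>
    (a + k * a', b + k * b', c + k * c', d + k * d', e + k * e', f + k * f', g + k * g')

def reflT (x y : T7) : T7 := axT (BT y x) y x

def posRoots : List T7 :=
  [
    (0, 1, -1, 0, 0, 0, 0), (0, 1, 0, -1, 0, 0, 0), (0, 1, 0, 0, -1, 0, 0), (0, 1, 0, 0, 0, -1, 0),
    (0, 1, 0, 0, 0, 0, -1), (0, 0, 1, -1, 0, 0, 0), (0, 0, 1, 0, -1, 0, 0), (0, 0, 1, 0, 0, -1, 0),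
    (0, 0, 1, 0, 0, 0, -1), (0, 0, 0, 1, -1, 0, 0), (0, 0, 0, 1, 0, -1, 0), (0, 0, 0, 1, 0, 0, -1),
    (0, 0, 0, 0, 1, -1, 0), (0, 0, 0, 0, 1, 0, -1), (0, 0, 0, 0, 0, 1, -1), (1, -1, -1, -1, 0, 0, 0),
    (1, -1, -1, 0, -1, 0, 0), (1, -1, -1, 0, 0, -1, 0), (1, -1, -1, 0, 0, 0, -1), (1, -1, 0, -1, -1, 0, 0),
    (1, -1, 0, -1, 0, -1, 0), (1, -1, 0, -1, 0, 0, -1), (1, -1, 0, 0, -1, -1, 0), (1, -1, 0, 0, -1, 0, -1),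
    (1, -1, 0, 0, 0, -1, -1), (1, 0, -1, -1, -1, 0, 0), (1, 0, -1, -1, 0, -1, 0), (1, 0, -1, -1, 0, 0, -1),
    (1, 0, -1, 0, -1, -1, 0), (1, 0, -1, 0, -1, 0, -1), (1, 0, -1, 0, 0, -1, -1), (1, 0, 0, -1, -1, -1, 0),
    (1, 0, 0, -1, -1, 0, -1), (1, 0, 0, -1, 0, -1, -1), (1, 0, 0, 0, -1, -1, -1), (2, -1, -1, -1, -1, -1, -1)]

def negT : T7 → T7
  | (a, b, c, d, e, f, g) => (-a, -b, -c, -d, -e, -f, -g)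

def rootList : List T7 := posRoots ++ posRoots.map negT

theorem B_toF (x y : T7) : B (toF x) (toF y) = BT x y := by
  obtain ⟨a, b, c, d, e, f, g⟩ := x
  obtain ⟨a', b', c', d', e', f', g'⟩ := y
  simp [B, toF, BT, Fin.sum_univ_succ]
  ring

theorem reflect_toF (x y : T7) : reflect (toF x) (toF y) = toF (reflT x y) := by
  unfold reflect reflT
  rw [B_toF]
  generalize BT y x = k
  obtain ⟨a, b, c, d, e, f, g⟩ := x
  obtain ⟨a', b', c', d', e', f', g'⟩ := y
  ext i
  fin_cases i <;> simp [toF, axT]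

theorem toF_inj : Function.Injective toF := by
  rintro ⟨a, b, c, d, e, f, g⟩ ⟨a', b', c', d', e', f', g'⟩ hh
  have e0 := congrFun hh 0
  have e1 := congrFun hh 1
  have e2 := congrFun hh 2
  have e3 := congrFun hh 3
  have e4 := congrFun hh 4
  have e5 := congrFun hh 5
  have e6 := congrFun hh 6
  simp [toF] at e0 e1 e2 e3 e4 e5 e6
  simp [*]

theorem rootList_complete : ∀ a ∈ [(-2 : ℤ), -1, 0, 1, 2], ∀ b ∈ [(-1 : ℤ), 0, 1],
    ∀ c ∈ [(-1 : ℤ), 0, 1], ∀ d ∈ [(-1 : ℤ), 0, 1], ∀ e ∈ [(-1 : ℤ), 0, 1],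
    ∀ f ∈ [(-1 : ℤ), 0, 1], ∀ g ∈ [(-1 : ℤ), 0, 1],
    BT (a, b, c, d, e, f, g) (a, b, c, d, e, f, g) = -2 →
    BT (a, b, c, d, e, f, g) (3, -1, -1, -1, -1, -1, -1) = 0 →
    (rootList.any fun y => eqT (a, b, c, d, e, f, g) y) = true := by
  decide +kernel

theorem rootList_sound : ∀ x ∈ rootList, BT x x = -2 ∧ BT x (3, -1, -1, -1, -1, -1, -1) = 0 := by
  decide +kernel

def code : T7 → ℕ
  | (a, b, c, d, e, f, g) => Int.toNat
    (a + 2 + 5 * (b + 2 + 5 * (c + 2 + 5 * (d + 2 + 5 * (e + 2 + 5 * (f + 2 + 5 * (g + 2)))))))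

theorem rootList_code_nodup : (rootList.map code).Nodup := by decide +kernel

theorem rootList_nodup : rootList.Nodup := List.Nodup.of_map code rootList_code_nodup

theorem h_eq : h = toF (3, -1, -1, -1, -1, -1, -1) := by
  ext i
  fin_cases i <;> simp [h, toF]

theorem coord_bound (a x b c d e f : ℤ)
    (hs : a * a - (x * x + b * b + c * c + d * d + e * e + f * f) = -2)
    (hl : 3 * a + (x + b + c + d + e + f) = 0) : x ∈ [(-1 : ℤ), 0, 1] := by
  have key : (3 * a + x) ^ 2 ≤ 5 * (b * b + c * c + d * d + e * e + f * f) := by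
    have : 3 * a + x = -(b + c + d + e + f) := by linarith
    rw [this]
    nlinarith [sq_nonneg (b - c), sq_nonneg (b - d), sq_nonneg (b - e), sq_nonneg (b - f),
      sq_nonneg (c - d), sq_nonneg (c - e), sq_nonneg (c - f), sq_nonneg (d - e),
      sq_nonneg (d - f), sq_nonneg (e - f)]
  have k2 : 15 * x ^ 2 ≤ 40 := by nlinarith [sq_nonneg (4 * a + 3 * x)]
  have u : x < 2 := by nlinarith
  have l : -2 < x := by nlinarith
  simp
  omega

theorem R_eq : R = toF '' {x | x ∈ rootList} := by
  ext α
  constructor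
  · rintro ⟨hs, hl⟩
    have hα : α = toF (α 0, α 1, α 2, α 3, α 4, α 5, α 6) := by
      ext i
      fin_cases i <;> simp [toF]
    rw [h_eq] at hl
    rw [hα] at hs hl ⊢
    generalize α 0 = a at *
    generalize α 1 = b at *
    generalize α 2 = c at *
    generalize α 3 = d at *
    generalize α 4 = e at *
    generalize α 5 = f at *
    generalize α 6 = g at *
    rw [B_toF] at hs hl
    refine ⟨_, ?_, rfl⟩
    have hs' := hs
    have hl' := hl
    simp only [BT] at hs' hl'
    have hb := coord_bound a b c d e f g (by linarith) (by linarith)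
    have hc := coord_bound a c b d e f g (by linarith) (by linarith)
    have hd := coord_bound a d c b e f g (by linarith) (by linarith)
    have he := coord_bound a e c d b f g (by linarith) (by linarith)
    have hf := coord_bound a f c d e b g (by linarith) (by linarith)
    have hg := coord_bound a g c d e f b (by linarith) (by linarith)
    have ha : a ∈ [(-2 : ℤ), -1, 0, 1, 2] := by
      simp at hb hc hd he hf hg ⊢
      omega
    have hmem := rootList_complete a ha b hb c hc d hd e he f hf g hg hs hl
    obtain ⟨y, hy, hxy⟩ := List.any_eq_true.mp hmem
    rw [(eqT_iff _ _).mp hxy]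
    exact hy
  · rintro ⟨x, hx, rfl⟩
    have := rootList_sound x hx
    refine ⟨?_, ?_⟩
    · rw [B_toF]; exact this.1
    · rw [h_eq, B_toF]; exact this.2

/-! Bilinearity. -/

theorem B_symm (x y : Fin 7 → ℤ) : B x y = B y x := by
  simp [B, Fin.sum_univ_succ]; ring

theorem B_add_smul (x y z : Fin 7 → ℤ) (k : ℤ) : B (x + k • y) z = B x z + k * B y z := by
  simp [B, Fin.sum_univ_succ]; ring

theorem B_reflect_left (a x z : Fin 7 → ℤ) : B (reflect a x) z = B x z + B x a * B a z :=
  B_add_smul _ _ _ _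

theorem B_reflect {a : Fin 7 → ℤ} (ha : a ∈ R) (x y : Fin 7 → ℤ) :
    B (reflect a x) (reflect a y) = B x y := by
  rw [B_reflect_left, B_symm x (reflect a y), B_symm a (reflect a y), B_reflect_left,
    B_reflect_left, B_symm y x, ha.1, B_symm a x]
  ring

theorem reflect_mem {a x : Fin 7 → ℤ} (ha : a ∈ R) (hx : x ∈ R) : reflect a x ∈ R := by
  refine ⟨by rw [B_reflect ha]; exact hx.1, ?_⟩
  rw [B_reflect_left, hx.2, ha.2]; simp

theorem reflect_reflect {a : Fin 7 → ℤ} (ha : a ∈ R) (x : Fin 7 → ℤ) :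
    reflect a (reflect a x) = x := by
  have : B (reflect a x) a = - B x a := by rw [B_reflect_left, ha.1]; ring
  rw [reflect, this, reflect]
  simp

/-! The dominant roots: one for each orbit. -/

def Dom (x y z : Fin 7 → ℤ) : Set (Fin 7 → ℤ) :=
  {β | β ∈ R ∧ 0 ≤ B β x ∧ 0 ≤ B β y ∧ 0 ≤ B β z}

def Good (x : Fin 7 → ℤ) : Prop := ∀ y ∈ R, ∀ z ∈ R, B x y = 1 → B x z = 0 → B y z = 0 →
  (Dom x y z).ncard = 22

theorem Dom_reflect {a : Fin 7 → ℤ} (ha : a ∈ R) (x y z : Fin 7 → ℤ) :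
    Dom (reflect a x) (reflect a y) (reflect a z) = reflect a '' Dom x y z := by
  ext β
  constructor
  · rintro ⟨h0, h1, h2, h3⟩
    refine ⟨reflect a β, ⟨reflect_mem ha h0, ?_, ?_, ?_⟩, reflect_reflect ha β⟩
    · rwa [← B_reflect ha, reflect_reflect ha]
    · rwa [← B_reflect ha, reflect_reflect ha]
    · rwa [← B_reflect ha, reflect_reflect ha]
  · rintro ⟨γ, ⟨h0, h1, h2, h3⟩, rfl⟩
    refine ⟨reflect_mem ha h0, ?_, ?_, ?_⟩ <;> rwa [B_reflect ha]

theorem Good_of_reflect {a x : Fin 7 → ℤ} (ha : a ∈ R) (hx : Good (reflect a x)) : Good x := by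
  intro y hy z hz hxy hxz hyz
  have := hx (reflect a y) (reflect_mem ha hy) (reflect a z) (reflect_mem ha hz)
    (by rwa [B_reflect ha]) (by rwa [B_reflect ha]) (by rwa [B_reflect ha])
  rw [Dom_reflect ha, Set.ncard_image_of_injective] at this
  · exact this
  · exact Function.LeftInverse.injective (reflect_reflect ha)

def baseRoot : T7 := (0, 1, -1, 0, 0, 0, 0)

def domList (x y z : T7) : List T7 :=
  rootList.filter fun b => decide (0 ≤ BT b x) && decide (0 ≤ BT b y) && decide (0 ≤ BT b z)

theorem base_count : ∀ y ∈ rootList, BT baseRoot y = 1 → ∀ z ∈ rootList,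
    BT baseRoot z = 0 → BT y z = 0 → (domList baseRoot y z).length = 22 := by
  decide +kernel

theorem base_trans_bool : (rootList.all fun x => rootList.any fun b =>
    decide (BT (reflT b x) baseRoot < 0) &&
      rootList.any fun a => eqT (reflT a (reflT b x)) baseRoot) = true := by
  decide +kernel

theorem base_trans : ∀ x ∈ rootList, ∃ a ∈ rootList, ∃ b ∈ rootList,
    reflT a (reflT b x) = baseRoot := by
  intro x hx
  obtain ⟨b, hb, hb2⟩ := List.any_eq_true.mp (List.all_eq_true.mp base_trans_bool x hx)
  obtain ⟨a, ha, hab⟩ := List.any_eq_true.mp (Bool.and_eq_true _ _ ▸ hb2).2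
  exact ⟨a, ha, b, hb, (eqT_iff _ _).mp hab⟩

theorem Dom_toF (x y z : T7) :
    Dom (toF x) (toF y) (toF z) = toF '' ((domList x y z).toFinset : Set T7) := by
  ext β
  simp only [Dom, R_eq, domList]
  constructor
  · rintro ⟨⟨b, hb, rfl⟩, h1, h2, h3⟩
    rw [B_toF] at h1 h2 h3
    refine ⟨b, ?_, rfl⟩
    simp only [Set.mem_setOf_eq] at hb
    simp [hb, h1, h2, h3]
  · rintro ⟨b, hb, rfl⟩
    simp at hb
    refine ⟨⟨b, hb.1, rfl⟩, ?_, ?_, ?_⟩ <;> rw [B_toF]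
    · exact hb.2.1.1
    · exact hb.2.1.2
    · exact hb.2.2

theorem good_base : Good (toF baseRoot) := by
  intro y hy z hz hxy hxz hyz
  rw [R_eq] at hy hz
  obtain ⟨y, hy, rfl⟩ := hy
  obtain ⟨z, hz, rfl⟩ := hz
  rw [B_toF] at hxy hxz hyz
  rw [Dom_toF, Set.ncard_image_of_injective _ toF_inj, Set.ncard_coe_finset,
    List.toFinset_card_of_nodup]
  · exact base_count y hy hxy z hz hxz hyz
  · exact rootList_nodup.filter _

theorem good_all {x : Fin 7 → ℤ} (hx : x ∈ R) : Good x := by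
  have hx' := hx
  rw [R_eq] at hx'
  obtain ⟨x, hx', rfl⟩ := hx'
  obtain ⟨a, ha, b, hb, hab⟩ := base_trans x hx'
  have ha' : toF a ∈ R := by rw [R_eq]; exact ⟨a, ha, rfl⟩
  have hb' : toF b ∈ R := by rw [R_eq]; exact ⟨b, hb, rfl⟩
  apply Good_of_reflect hb'
  apply Good_of_reflect ha'
  rw [reflect_toF, reflect_toF, hab]
  exact good_base

/-! The explicit dominant representative, from the numbers `B β δᵢ`. -/

def nf (x y z β : Fin 7 → ℤ) : Fin 7 → ℤ :=
  β + (-max 0 (max (-B β x) (-B β x - B β y))) • x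
    + (-max 0 (max (-B β y) (-B β x - B β y))) • y + (-max 0 (-B β z)) • z

theorem nf_dom {x y z β : Fin 7 → ℤ} (h1 : 0 ≤ B β x) (h2 : 0 ≤ B β y) (h3 : 0 ≤ B β z) :
    nf x y z β = β := by
  have e1 : max 0 (max (-B β x) (-B β x - B β y)) = 0 := by omega
  have e2 : max 0 (max (-B β y) (-B β x - B β y)) = 0 := by omega
  have e3 : max 0 (-B β z) = 0 := by omega
  rw [nf, e1, e2, e3]
  simp

section orbits

variable {x y z : Fin 7 → ℤ}

theorem nf_congr {β β' : Fin 7 → ℤ} (a b c : ℤ) (hβ : β' = β + a • x + b • y + c • z)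
    (h1 : max 0 (max (-B β' x) (-B β' x - B β' y)) =
      max 0 (max (-B β x) (-B β x - B β y)) + a)
    (h2 : max 0 (max (-B β' y) (-B β' x - B β' y)) =
      max 0 (max (-B β y) (-B β x - B β y)) + b)
    (h3 : max 0 (-B β' z) = max 0 (-B β z) + c) : nf x y z β' = nf x y z β := by
  rw [nf, nf, h1, h2, h3, hβ]
  module

theorem pairing_x (hx : x ∈ R) (hxy : B x y = 1) (hxz : B x z = 0) (β : Fin 7 → ℤ) :
    B (reflect x β) x = -B β x ∧ B (reflect x β) y = B β x + B β y ∧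
    B (reflect x β) z = B β z := by
  simp only [B_reflect_left, hx.1, hxy, hxz]
  refine ⟨?_, ?_, ?_⟩ <;> ring

theorem pairing_y (hy : y ∈ R) (hxy : B x y = 1) (hyz : B y z = 0) (β : Fin 7 → ℤ) :
    B (reflect y β) x = B β x + B β y ∧ B (reflect y β) y = -B β y ∧
    B (reflect y β) z = B β z := by
  simp only [B_reflect_left, hy.1, B_symm y x, hxy, hyz]
  refine ⟨?_, ?_, ?_⟩ <;> ring

theorem pairing_z (hz : z ∈ R) (hxz : B x z = 0) (hyz : B y z = 0) (β : Fin 7 → ℤ) :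
    B (reflect z β) x = B β x ∧ B (reflect z β) y = B β y ∧
    B (reflect z β) z = -B β z := by
  simp only [B_reflect_left, hz.1, B_symm z x, B_symm z y, hxz, hyz]
  refine ⟨?_, ?_, ?_⟩ <;> ring

end orbits

/-- For three roots spanning a sub-root system of type `A₁ + A₂` (here `δ₁, δ₂` form the
`A₂` and `δ₃` the `A₁`), the subgroup generated by the three reflections has exactly 22
orbits on the 72 roots. -/
theorem orbits_A1_A2 (δ₁ δ₂ δ₃ : Fin 7 → ℤ) (h₁ : δ₁ ∈ R) (h₂ : δ₂ ∈ R) (h₃ : δ₃ ∈ R)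
    (h12 : B δ₁ δ₂ = 1) (h13 : B δ₁ δ₃ = 0) (h23 : B δ₂ δ₃ = 0)
    (hne31 : δ₃ ≠ δ₁ ∧ δ₃ ≠ -δ₁) (hne32 : δ₃ ≠ δ₂ ∧ δ₃ ≠ -δ₂)
    (g₁ g₂ g₃ : Equiv.Perm (Fin 7 → ℤ))
    (hg₁ : ∀ β, g₁ β = reflect δ₁ β) (hg₂ : ∀ β, g₂ β = reflect δ₂ β)
    (hg₃ : ∀ β, g₃ β = reflect δ₃ β) :
    {O : Set (Fin 7 → ℤ) | ∃ β ∈ R,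
      O = MulAction.orbit
        (Subgroup.closure {g₁, g₂, g₃} : Subgroup (Equiv.Perm (Fin 7 → ℤ))) β}.ncard
      = 22 := by
  -- the normal form is constant on orbits, and orbits stay inside `R`
  have inv : ∀ w ∈ Subgroup.closure {g₁, g₂, g₃}, ∀ β,
      nf δ₁ δ₂ δ₃ (w β) = nf δ₁ δ₂ δ₃ β ∧ (w β ∈ R ↔ β ∈ R) := by
    intro w hw
    have mem_iff : ∀ δ ∈ R, ∀ β, reflect δ β ∈ R ↔ β ∈ R := fun δ hδ β =>
      ⟨fun hb => by simpa [reflect_reflect hδ] using reflect_mem hδ hb, reflect_mem hδ⟩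
    have gen : ∀ w ∈ ({g₁, g₂, g₃} : Set (Equiv.Perm (Fin 7 → ℤ))), ∀ β,
        nf δ₁ δ₂ δ₃ (w β) = nf δ₁ δ₂ δ₃ β ∧ (w β ∈ R ↔ β ∈ R) := by
      intro w hw β
      simp only [Set.mem_insert_iff, Set.mem_singleton_iff] at hw
      rcases hw with hw | hw | hw
      · rw [hw, hg₁]
        obtain ⟨e1, e2, e3⟩ := pairing_x h₁ h12 h13 β
        refine ⟨nf_congr (B β δ₁) 0 0 (by simp [reflect]) ?_ ?_ ?_, mem_iff _ h₁ β⟩ <;>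
          simp only [e1, e2, e3] <;> omega
      · rw [hw, hg₂]
        obtain ⟨e1, e2, e3⟩ := pairing_y h₂ h12 h23 β
        refine ⟨nf_congr 0 (B β δ₂) 0 (by simp [reflect]) ?_ ?_ ?_, mem_iff _ h₂ β⟩ <;>
          simp only [e1, e2, e3] <;> omega
      · rw [hw, hg₃]
        obtain ⟨e1, e2, e3⟩ := pairing_z h₃ h13 h23 β
        refine ⟨nf_congr 0 0 (B β δ₃) (by simp [reflect]) ?_ ?_ ?_, mem_iff _ h₃ β⟩ <;>
          simp only [e1, e2, e3] <;> omega
    induction hw using Subgroup.closure_induction with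
    | mem w hw => exact gen w hw
    | one => intro β; simp
    | mul u v _ _ hu hv =>
      intro β
      rw [Equiv.Perm.mul_apply]
      exact ⟨(hu _).1.trans (hv _).1, (hu _).2.trans (hv _).2⟩
    | inv u _ hu =>
      intro β
      have := hu (u⁻¹ β)
      have hc : u (u⁻¹ β) = β := u.apply_symm_apply β
      rw [hc] at this
      exact ⟨this.1.symm, this.2.symm⟩
  set G := Subgroup.closure {g₁, g₂, g₃} with hG
  have s1 : ∀ β γ, γ ∈ MulAction.orbit G β → reflect δ₁ γ ∈ MulAction.orbit G β := by
    rintro β γ ⟨w, rfl⟩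
    exact ⟨⟨g₁, Subgroup.subset_closure (by simp)⟩ * w, hg₁ _⟩
  have s2 : ∀ β γ, γ ∈ MulAction.orbit G β → reflect δ₂ γ ∈ MulAction.orbit G β := by
    rintro β γ ⟨w, rfl⟩
    exact ⟨⟨g₂, Subgroup.subset_closure (by simp)⟩ * w, hg₂ _⟩
  have s3 : ∀ β γ, γ ∈ MulAction.orbit G β → reflect δ₃ γ ∈ MulAction.orbit G β := by
    rintro β γ ⟨w, rfl⟩
    exact ⟨⟨g₃, Subgroup.subset_closure (by simp)⟩ * w, hg₃ _⟩
  -- every orbit meets the dominant chamber of the `A₂` factor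
  have dom2 : ∀ β, ∃ γ ∈ MulAction.orbit G β, 0 ≤ B γ δ₁ ∧ 0 ≤ B γ δ₂ := by
    intro β
    have m0 : β ∈ MulAction.orbit G β := MulAction.mem_orbit_self β
    have m1 := s1 _ _ m0
    have m2 := s2 _ _ m0
    have m21 := s2 _ _ m1
    have m12 := s1 _ _ m2
    have m121 := s1 _ _ m21
    obtain ⟨p1, q1, -⟩ := pairing_x h₁ h12 h13 β
    obtain ⟨p2, q2, -⟩ := pairing_y h₂ h12 h23 β
    obtain ⟨p21, q21, -⟩ := pairing_y h₂ h12 h23 (reflect δ₁ β)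
    obtain ⟨p12, q12, -⟩ := pairing_x h₁ h12 h13 (reflect δ₂ β)
    obtain ⟨p121, q121, -⟩ := pairing_x h₁ h12 h13 (reflect δ₂ (reflect δ₁ β))
    by_cases hp : 0 ≤ B β δ₁
    · by_cases hq : 0 ≤ B β δ₂
      · exact ⟨_, m0, hp, hq⟩
      · by_cases hpq : 0 ≤ B β δ₁ + B β δ₂
        · exact ⟨_, m2, by omega, by omega⟩
        · exact ⟨_, m12, by omega, by omega⟩
    · by_cases hpq : 0 ≤ B β δ₁ + B β δ₂
      · exact ⟨_, m1, by omega, by omega⟩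
      · by_cases hq : 0 ≤ B β δ₂
        · exact ⟨_, m21, by omega, by omega⟩
        · exact ⟨_, m121, by omega, by omega⟩
  have dom3 : ∀ β, ∃ γ ∈ MulAction.orbit G β, 0 ≤ B γ δ₁ ∧ 0 ≤ B γ δ₂ ∧ 0 ≤ B γ δ₃ := by
    intro β
    obtain ⟨γ, m, hp, hq⟩ := dom2 β
    by_cases hr : 0 ≤ B γ δ₃
    · exact ⟨γ, m, hp, hq, hr⟩
    · obtain ⟨e1, e2, e3⟩ := pairing_z h₃ h13 h23 γ
      exact ⟨_, s3 _ _ m, by omega, by omega, by omega⟩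
  have himg : {O : Set (Fin 7 → ℤ) | ∃ β ∈ R, O = MulAction.orbit G β} =
      (fun β => MulAction.orbit G β) '' Dom δ₁ δ₂ δ₃ := by
    ext O
    constructor
    · rintro ⟨β, hβ, rfl⟩
      obtain ⟨γ, m, hd⟩ := dom3 β
      refine ⟨γ, ⟨?_, hd⟩, MulAction.orbit_eq_iff.mpr m⟩
      obtain ⟨w, rfl⟩ := m
      exact (inv w.1 w.2 β).2.mpr hβ
    · rintro ⟨β, hβ, rfl⟩
      exact ⟨β, hβ.1, rfl⟩
  rw [himg, Set.ncard_image_of_injOn]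
  · exact good_all h₁ δ₂ h₂ δ₃ h₃ h12 h13 h23
  · rintro β ⟨-, b1, b2, b3⟩ γ ⟨-, c1, c2, c3⟩ hbc
    have m : β ∈ MulAction.orbit G γ := MulAction.orbit_eq_iff.mp hbc
    obtain ⟨w, hw⟩ := m
    have e := (inv w.1 w.2 γ).1
    have hw' : w.1 γ = β := hw
    rw [hw', nf_dom b1 b2 b3, nf_dom c1 c2 c3] at e
    exact e
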